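/- Asymptotic alternative for the Keiper–Li sequence, exponential form: the Riemann Hypothesis is true if and only if limsup_{n→∞} |λ_n^L|^{1/n} ≤ 1. (If RH is false, the sequence λ_n^L exhibits exponentially growing oscillations governed by the zeros off the critical line, so limsup |λ_n^L|^{1/n} > 1; if RH is true, λ_n^L grows only like (n/2)·log n.) -/

import Mathlib

open scoped Nat BigOperators

/-- The completed Riemann zeta function `2ξ(s) = s(s-1)π^{-s/2}Γ(s/2)ζ(s)`,
extended by its (entire) values `1` at `s = 0, 1`. -/
noncomputable def xi2 (s : ℂ) : ℂ :=
  if s = 0 ∨ s = 1 then 1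
  else s * (s - 1) * (Real.pi : ℂ) ^ (-s / 2) * Complex.Gamma (s / 2) * riemannZeta s

/-- The coefficients `A_{nm} = 2^{m-n} (2(n+m)-1)!! / ((2m-1)(n-m)!(2m)!)`. -/
noncomputable def A (n m : ℕ) : ℝ :=
  (2 : ℝ) ^ ((m : ℤ) - (n : ℤ)) * (Nat.doubleFactorial (2 * (n + m) - 1) : ℝ) /
    ((2 * (m : ℝ) - 1) * (Nat.factorial (n - m) : ℝ) * (Nat.factorial (2 * m) : ℝ))

/-- `Φ_m = log 2ξ(2m)`, a real number (the value `2ξ(2m)` is a positive real). -/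
noncomputable def PhiVal (m : ℕ) : ℝ := (Complex.log (xi2 (2 * m))).re

/-- The closed-form variant `Λ_n` of the Keiper sequence. -/
noncomputable def Lambda (n : ℕ) : ℝ := ∑ m ∈ Finset.Icc 1 n, (-1 : ℝ) ^ m * A n m * PhiVal m

/-- `Φ(z) = log 2ξ(1/(1-z))` (principal branch), analytic near `z = 0`. -/
noncomputable def PhiKL (z : ℂ) : ℂ := Complex.log (xi2 (1 / (1 - z)))

/-- Keiper's constants `λ_n^K`: the `n`-th Taylor coefficient of `Φ` at `0`
(a real number; we take the real part). -/
noncomputable def lambdaK (n : ℕ) : ℝ := (iteratedDeriv n PhiKL 0 / (Nat.factorial n : ℂ)).re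

/-- Li's constants `λ_n^L = n·λ_n^K`. -/
noncomputable def lambdaL (n : ℕ) : ℝ := n * lambdaK n

open Filter Topology Metric Complex ComplexConjugate

/-- The entire function `s (s - 1) Λ₀(s) + 1`, which is the analytic continuation of `xi2`. -/
noncomputable def xiEntire (s : ℂ) : ℂ := s * (s - 1) * completedRiemannZeta₀ s + 1

theorem differentiable_xiEntire : Differentiable ℂ xiEntire := by
  have := differentiable_completedZeta₀
  unfold xiEntire
  fun_prop

theorem xiEntire_one_sub (s : ℂ) : xiEntire (1 - s) = xiEntire s := by
  rw [xiEntire, xiEntire, completedRiemannZeta₀_one_sub]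
  ring

theorem xiEntire_eq_mul_riemannZeta {s : ℂ} (h0 : s ≠ 0) (h1 : s ≠ 1) (hG : Gammaℝ s ≠ 0) :
    xiEntire s = s * (s - 1) * Gammaℝ s * riemannZeta s := by
  have h2 : 1 - s ≠ 0 := sub_ne_zero.mpr h1.symm
  rw [riemannZeta_def_of_ne_zero h0, mul_assoc, mul_div_cancel₀ _ hG, completedRiemannZeta_eq,
    xiEntire]
  field_simp
  ring

theorem xi2_eq_xiEntire {s : ℂ} (hs : 0 < s.re) : xi2 s = xiEntire s := by
  have h0 : s ≠ 0 := by rintro rfl; simp at hs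
  by_cases h1 : s = 1
  · simp [xi2, xiEntire, h1]
  · rw [xiEntire_eq_mul_riemannZeta h0 h1 (Gammaℝ_ne_zero_of_re_pos hs), xi2,
      if_neg (by tauto), Gammaℝ_def]
    ring

/-- The pullback of `xiEntire` along `z ↦ 1 / (1 - z)`, which maps the unit disc onto the
half-plane `1 / 2 < re s`. -/
noncomputable def xiDisc (z : ℂ) : ℂ := xiEntire (1 / (1 - z))

theorem one_sub_ne_zero_of_mem_ball {z : ℂ} (hz : z ∈ ball (0 : ℂ) 1) : 1 - z ≠ 0 := by
  intro h
  rw [← sub_eq_zero.mp h] at hz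
  simp at hz

theorem differentiableOn_xiDisc : DifferentiableOn ℂ xiDisc (ball 0 1) := by
  intro z hz
  apply DifferentiableAt.differentiableWithinAt
  have h1 : DifferentiableAt ℂ (fun z : ℂ => 1 / (1 - z)) z := by
    have := one_sub_ne_zero_of_mem_ball hz
    fun_prop (disch := assumption)
  exact (differentiable_xiEntire _).comp z h1

theorem xiDisc_zero : xiDisc 0 = 1 := by
  simp [xiDisc, xiEntire]

theorem half_lt_re_of_mem_ball {z : ℂ} (hz : z ∈ ball (0 : ℂ) 1) :
    1 / 2 < (1 / (1 - z)).re := by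
  have h := one_sub_ne_zero_of_mem_ball hz
  have hn : 0 < normSq (1 - z) := normSq_pos.mpr h
  have hz' : normSq z < 1 := by
    rw [mem_ball_zero_iff] at hz
    rw [normSq_eq_norm_sq]
    nlinarith [norm_nonneg z]
  rw [one_div (1 - z), inv_re, lt_div_iff₀ hn]
  simp only [normSq_apply, sub_re, sub_im, one_re, one_im] at *
  nlinarith

theorem one_sub_inv_mem_ball {s : ℂ} (hs : 1 / 2 < s.re) : 1 - s⁻¹ ∈ ball (0 : ℂ) 1 := by
  have h0 : s ≠ 0 := by rintro rfl; norm_num at hs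
  have hn : 0 < ‖s‖ := norm_pos_iff.mpr h0
  have h : ‖s - 1‖ < ‖s‖ := by
    rw [← sq_lt_sq₀ (norm_nonneg _) (norm_nonneg _), ← normSq_eq_norm_sq, ← normSq_eq_norm_sq]
    simp only [normSq_apply, sub_re, sub_im, one_re, one_im]
    nlinarith
  have h2 : 1 - s⁻¹ = (s - 1) / s := by field_simp
  rw [mem_ball_zero_iff, h2, norm_div, div_lt_one hn]
  exact h

theorem xiDisc_one_sub_inv (s : ℂ) : xiDisc (1 - s⁻¹) = xiEntire s := by
  simp [xiDisc]

theorem riemannHypothesis_iff_xiDisc_ne_zero :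
    RiemannHypothesis ↔ ∀ z ∈ ball (0 : ℂ) 1, xiDisc z ≠ 0 := by
  constructor
  · intro hRH z hz h0
    have hre := half_lt_re_of_mem_ball hz
    rw [xiDisc] at h0
    set s := 1 / (1 - z)
    have hs0 : s ≠ 0 := by intro h; rw [h] at hre; norm_num at hre
    have hs1 : s ≠ 1 := by intro h; rw [h] at h0; simp [xiEntire] at h0
    have hG : Gammaℝ s ≠ 0 := Gammaℝ_ne_zero_of_re_pos (by linarith)
    rw [xiEntire_eq_mul_riemannZeta hs0 hs1 hG] at h0
    have hζ : riemannZeta s = 0 := by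
      simpa [hs0, hG, sub_eq_zero, hs1] using h0
    refine hre.ne' (hRH s hζ ?_ hs1)
    rintro ⟨n, hn⟩
    rw [hn] at hre
    norm_num at hre
    linarith [(Nat.cast_nonneg n : (0 : ℝ) ≤ n)]
  · intro h s hζ htriv hs1
    have key : ∀ w : ℂ, xiEntire w = 0 → w.re ≤ 1 / 2 := by
      intro w hw
      by_contra! hlt
      exact h _ (one_sub_inv_mem_ball hlt) (by rw [xiDisc_one_sub_inv, hw])
    have hs0 : s ≠ 0 := by
      rintro rfl
      norm_num [riemannZeta_zero] at hζ
    have hG : Gammaℝ s ≠ 0 := by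
      rw [Ne, Gammaℝ_eq_zero_iff]
      rintro ⟨n, hn⟩
      cases n with
      | zero => simp at hn; exact hs0 hn
      | succ n => exact htriv ⟨n, by rw [hn]; push_cast; ring⟩
    have hX : xiEntire s = 0 := by
      rw [xiEntire_eq_mul_riemannZeta hs0 hs1 hG, hζ, mul_zero]
    have h1 := key s hX
    have h2 := key (1 - s) (by rw [xiEntire_one_sub, hX])
    simp only [sub_re, one_re] at h2
    linarith

theorem PhiKL_eq_log_xiDisc {z : ℂ} (hz : z ∈ ball (0 : ℂ) 1) : PhiKL z = log (xiDisc z) := by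
  rw [PhiKL, xiDisc, xi2_eq_xiEntire (by linarith [half_lt_re_of_mem_ball hz])]

theorem exists_ball_xiDisc_mem_slitPlane :
    ∃ R : ℝ, 0 < R ∧ R ≤ 1 ∧ ∀ z ∈ ball (0 : ℂ) R, xiDisc z ∈ slitPlane := by
  have hc : ContinuousAt xiDisc 0 :=
    (differentiableOn_xiDisc.differentiableAt (ball_mem_nhds 0 one_pos)).continuousAt
  have h : ∀ᶠ z in 𝓝 0, xiDisc z ∈ slitPlane :=
    hc.eventually_mem (isOpen_slitPlane.mem_nhds (by rw [xiDisc_zero]; exact one_mem_slitPlane))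
  obtain ⟨ε, hε, H⟩ := Metric.eventually_nhds_iff_ball.mp h
  exact ⟨min ε 1, by positivity, min_le_right _ _,
    fun z hz => H z (ball_subset_ball (min_le_left _ _) hz)⟩

theorem exists_ball_differentiableOn_PhiKL :
    ∃ R : ℝ, 0 < R ∧ R ≤ 1 ∧ DifferentiableOn ℂ PhiKL (ball 0 R) ∧
      ∀ z ∈ ball (0 : ℂ) R, exp (PhiKL z) = xiDisc z := by
  obtain ⟨R, hR, hR1, H⟩ := exists_ball_xiDisc_mem_slitPlane
  have hsub : ball (0 : ℂ) R ⊆ ball 0 1 := ball_subset_ball hR1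
  refine ⟨R, hR, hR1, ?_, fun z hz => ?_⟩
  · exact ((differentiableOn_xiDisc.mono hsub).clog H).congr
      fun z hz => PhiKL_eq_log_xiDisc (hsub hz)
  · rw [PhiKL_eq_log_xiDisc (hsub hz), exp_log (slitPlane_ne_zero (H z hz))]

/-- A nonvanishing holomorphic function on a disc has a holomorphic logarithm. -/
theorem exists_differentiableOn_exp_eq {f : ℂ → ℂ} {c : ℂ} {R : ℝ} (hR : 0 < R)
    (hf : DifferentiableOn ℂ f (ball c R)) (h0 : ∀ z ∈ ball c R, f z ≠ 0) :
    ∃ g : ℂ → ℂ, DifferentiableOn ℂ g (ball c R) ∧ g c = log (f c) ∧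
      ∀ z ∈ ball c R, exp (g z) = f z := by
  have hd : DifferentiableOn ℂ (fun z => deriv f z / f z) (ball c R) :=
    (hf.deriv isOpen_ball).div hf h0
  obtain ⟨g, hgc, hg⟩ := hd.isExactOn_ball.with_val_at c (log (f c))
  have hc : c ∈ ball c R := mem_ball_self hR
  refine ⟨g, fun z hz => (hg z hz).differentiableAt.differentiableWithinAt, hgc, fun z hz => ?_⟩
  have hderiv : ∀ w ∈ ball c R, HasDerivAt (fun z => f z * exp (-g z)) 0 w := by
    intro w hw
    have hfw := (hf.differentiableAt (isOpen_ball.mem_nhds hw)).hasDerivAt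
    have hfw0 := h0 w hw
    refine (hfw.fun_mul (hg w hw).fun_neg.cexp).congr_deriv ?_
    field_simp
    ring
  have hconst := (convex_ball c R).is_const_of_fderivWithin_eq_zero (𝕜 := ℂ)
    (fun w hw => (hderiv w hw).differentiableAt.differentiableWithinAt)
    (fun w hw => by
      rw [fderivWithin_of_isOpen isOpen_ball hw]
      ext
      simp [(hderiv w hw).deriv]) hz hc
  simp only [hgc, exp_neg, exp_log (h0 c hc), mul_inv_cancel₀ (h0 c hc)] at hconst
  exact ((mul_inv_eq_one₀ (exp_ne_zero _)).mp hconst).symm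

theorem eventually_abs_lambdaL_le {f : ℂ → ℂ} {R r b : ℝ} (hr : 0 < r) (hrR : r < R)
    (hb : 1 / r < b) (hf : DifferentiableOn ℂ f (ball 0 R)) (hfΦ : PhiKL =ᶠ[𝓝 0] f) :
    ∀ᶠ n : ℕ in atTop, |lambdaL n| ≤ b ^ n := by
  have hsub : closedBall (0 : ℂ) r ⊆ ball 0 R := closedBall_subset_ball hrR
  have hdc : DiffContOnCl ℂ f (ball 0 r) :=
    DifferentiableOn.diffContOnCl ((hf.mono hsub).mono closure_ball_subset_closedBall)
  obtain ⟨C, hC⟩ := (isCompact_sphere (0 : ℂ) r).exists_bound_of_continuousOn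
    (hf.continuousOn.mono (sphere_subset_closedBall.trans hsub))
  have hbr : 1 < b * r := (div_lt_iff₀ hr).mp hb
  have hlim : Tendsto (fun n : ℕ => C * ((n : ℝ) ^ 1 / (b * r) ^ n)) atTop (𝓝 (C * 0)) :=
    (tendsto_pow_const_div_const_pow_of_one_lt 1 hbr).const_mul C
  rw [mul_zero] at hlim
  filter_upwards [hlim.eventually_lt_const one_pos] with n hn
  have hbrn : 0 < (b * r) ^ n := by positivity
  have hrn : 0 < r ^ n := by positivity
  have hcauchy := norm_iteratedDeriv_le_of_forall_mem_sphere_norm_le n hr hdc hC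
  have hK : |lambdaK n| ≤ C / r ^ n := by
    rw [lambdaK, hfΦ.iteratedDeriv_eq n]
    refine (abs_re_le_norm _).trans ?_
    rw [norm_div, norm_natCast, div_le_iff₀ (by positivity)]
    calc _ ≤ _ := hcauchy
      _ = _ := by ring
  rw [pow_one, ← mul_div_assoc, div_lt_one hbrn, mul_pow] at hn
  rw [lambdaL, abs_mul, Nat.abs_cast]
  calc (n : ℝ) * |lambdaK n| ≤ n * (C / r ^ n) := by gcongr
    _ = C * n / r ^ n := by ring
    _ ≤ b ^ n := by rw [div_le_iff₀ hrn]; exact hn.le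

theorem eventually_rpow_inv_le_iff {u : ℕ → ℝ} {b : ℝ} (hb : 0 ≤ b) :
    (∀ᶠ n : ℕ in atTop, |u n| ^ ((n : ℝ)⁻¹) ≤ b) ↔ ∀ᶠ n : ℕ in atTop, |u n| ≤ b ^ n := by
  refine eventually_congr ?_
  filter_upwards [eventually_gt_atTop 0] with n hn
  rw [Real.rpow_inv_le_iff_of_pos (abs_nonneg _) hb (by exact_mod_cast hn), Real.rpow_natCast]

theorem isBoundedUnder_lambdaL :
    IsBoundedUnder (· ≤ ·) atTop (fun n : ℕ => |lambdaL n| ^ ((n : ℝ)⁻¹)) := by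
  obtain ⟨R, hR, -, hd, -⟩ := exists_ball_differentiableOn_PhiKL
  refine ⟨1 / (R / 2) + 1, ?_⟩
  rw [eventually_map, eventually_rpow_inv_le_iff (by positivity)]
  exact eventually_abs_lambdaL_le (half_pos hR) (half_lt_self hR) (lt_add_one _) hd
    EventuallyEq.rfl

theorem limsup_le_one_of_xiDisc_ne_zero (h : ∀ z ∈ ball (0 : ℂ) 1, xiDisc z ≠ 0) :
    limsup (fun n : ℕ => |lambdaL n| ^ ((n : ℝ)⁻¹)) atTop ≤ 1 := by
  obtain ⟨g, hg, hg0, hexp⟩ := exists_differentiableOn_exp_eq one_pos differentiableOn_xiDisc h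
  rw [xiDisc_zero, log_one] at hg0
  have hball : ball (0 : ℂ) 1 ∈ 𝓝 0 := ball_mem_nhds 0 one_pos
  have heq : PhiKL =ᶠ[𝓝 0] g := by
    have hc : ContinuousAt (fun z => (g z).im) 0 :=
      continuous_im.continuousAt.comp (hg.differentiableAt hball).continuousAt
    have him : ∀ᶠ z in 𝓝 0, (g z).im ∈ Set.Ioo (-Real.pi) Real.pi :=
      hc.eventually_mem (Ioo_mem_nhds (by simp [hg0, Real.pi_pos]) (by simp [hg0, Real.pi_pos]))
    filter_upwards [him, hball] with z hz hz1
    rw [PhiKL_eq_log_xiDisc hz1, ← hexp z hz1, log_exp hz.1 hz.2.le]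
  refine le_of_forall_gt_imp_ge_of_dense fun b hb => ?_
  have hb0 : 0 < b := one_pos.trans hb
  refine limsup_le_of_le (IsCoboundedUnder.of_frequently_ge (a := 0)
    (Frequently.of_forall fun n => by positivity)) ?_
  rw [eventually_rpow_inv_le_iff hb0.le]
  obtain ⟨r, hr1, hr2⟩ := exists_between (inv_lt_one_of_one_lt₀ hb)
  have hr0 : 0 < r := (inv_pos.mpr hb0).trans hr1
  refine eventually_abs_lambdaL_le hr0 hr2 ?_ hg heq
  rw [one_div]
  exact inv_lt_of_inv_lt₀ hb0 hr1

/-- Near the origin the power series with coefficients `2 λ_n^K` sums to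
`Φ(z) + conj Φ(conj z)`. -/
theorem hasSum_lambdaK {R : ℝ} (hd : DifferentiableOn ℂ PhiKL (ball 0 R)) {z : ℂ}
    (hz : z ∈ ball (0 : ℂ) R) :
    HasSum (fun n : ℕ => ((2 * lambdaK n : ℝ) : ℂ) * z ^ n)
      (PhiKL z + conj (PhiKL (conj z))) := by
  have hz' : conj z ∈ ball (0 : ℂ) R := by simpa using hz
  have h1 := hasSum_taylorSeries_on_ball hd hz
  have h2 := (hasSum_taylorSeries_on_ball hd hz').map (starRingEnd ℂ) continuous_conj
  convert! h1.add h2 using 2 with n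
  simp only [Function.comp_apply, smul_eq_mul, map_mul, map_inv₀, map_pow, conj_conj,
    map_natCast, sub_zero, lambdaK]
  have := add_conj (iteratedDeriv n PhiKL 0 / (n.factorial : ℂ))
  rw [← this]
  simp only [map_div₀, map_natCast]
  ring

theorem analyticOnNhd_of_eventually_norm_le {c : ℕ → ℂ}
    (hc : ∀ b : ℝ, 1 < b → ∀ᶠ n in atTop, ‖c n‖ ≤ 2 * b ^ n) :
    AnalyticOnNhd ℂ (fun z => ∑' n, c n * z ^ n) (ball 0 1) := by
  have hrad : 1 ≤ (FormalMultilinearSeries.ofScalars ℂ c).radius := by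
    refine le_of_forall_lt_imp_le_of_dense fun r hr => ?_
    lift r to NNReal using hr.ne_top
    rcases eq_or_ne r 0 with rfl | hr0
    · simp
    have hr0' : (0 : ℝ) < r := by positivity
    have hr1 : (r : ℝ) < 1 := by exact_mod_cast hr
    refine FormalMultilinearSeries.le_radius_of_eventually_le _ 2 ?_
    filter_upwards [hc (r : ℝ)⁻¹ (one_lt_inv₀ hr0' |>.mpr hr1)] with n hn
    rw [FormalMultilinearSeries.ofScalars_norm]
    calc ‖c n‖ * (r : ℝ) ^ n ≤ 2 * (r : ℝ)⁻¹ ^ n * (r : ℝ) ^ n := by gcongr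
      _ = 2 := by rw [mul_assoc, ← mul_pow, inv_mul_cancel₀ hr0'.ne', one_pow, mul_one]
  have h := (FormalMultilinearSeries.ofScalars ℂ c).hasFPowerSeriesOnBall
    (one_pos.trans_le hrad)
  have h2 : (FormalMultilinearSeries.ofScalars ℂ c).sum = fun z => ∑' n, c n * z ^ n := by
    funext z
    exact FormalMultilinearSeries.ofScalars_sum_eq c z
  rw [h2] at h
  refine h.analyticOnNhd.mono ?_
  rw [← ENNReal.ofReal_one, ← Metric.eball_ofReal] at *
  exact Metric.eball_subset_eball hrad

theorem xiDisc_ne_zero_of_limsup_le_one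
    (h : limsup (fun n : ℕ => |lambdaL n| ^ ((n : ℝ)⁻¹)) atTop ≤ 1) :
    ∀ z ∈ ball (0 : ℂ) 1, xiDisc z ≠ 0 := by
  have hK : ∀ b : ℝ, 1 < b → ∀ᶠ n : ℕ in atTop, ‖((2 * lambdaK n : ℝ) : ℂ)‖ ≤ 2 * b ^ n := by
    intro b hb
    have hev := (eventually_lt_of_limsup_lt (h.trans_lt hb) isBoundedUnder_lambdaL).mono
      fun _ => le_of_lt
    rw [eventually_rpow_inv_le_iff (one_pos.trans hb).le] at hev
    filter_upwards [hev, eventually_ge_atTop 1] with n hn hn1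
    have hn1' : (1 : ℝ) ≤ n := by exact_mod_cast hn1
    rw [lambdaL, abs_mul, Nat.abs_cast] at hn
    rw [norm_real, Real.norm_eq_abs, abs_mul, abs_two]
    nlinarith [abs_nonneg (lambdaK n)]
  have hana := analyticOnNhd_of_eventually_norm_le hK
  obtain ⟨R, hR, -, hd, hexp⟩ := exists_ball_differentiableOn_PhiKL
  have hconj : DifferentiableOn ℂ (fun z => conj (xiDisc (conj z))) (ball 0 1) := by
    intro z hz
    have hz' : conj z ∈ ball (0 : ℂ) 1 := by simpa using hz
    have hd' := (differentiableOn_xiDisc.differentiableAt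
      (isOpen_ball.mem_nhds hz')).hasDerivAt.conj_conj
    rw [conj_conj] at hd'
    exact hd'.differentiableAt.differentiableWithinAt
  have heq : Set.EqOn (fun z => exp (∑' n : ℕ, ((2 * lambdaK n : ℝ) : ℂ) * z ^ n))
      (fun z => xiDisc z * conj (xiDisc (conj z))) (ball 0 1) := by
    refine AnalyticOnNhd.eqOn_of_preconnected_of_eventuallyEq (𝕜 := ℂ) (z₀ := 0) (fun w hw => (hana w hw).cexp)
      ((differentiableOn_xiDisc.mul hconj).analyticOnNhd isOpen_ball)
      (convex_ball 0 1).isPreconnected (mem_ball_self one_pos) ?_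
    filter_upwards [ball_mem_nhds 0 hR] with z hz
    have hz' : conj z ∈ ball (0 : ℂ) R := by simpa using hz
    rw [(hasSum_lambdaK hd hz).tsum_eq, exp_add, exp_conj, hexp z hz, hexp _ hz']
  intro z hz h0
  refine exp_ne_zero _ ((heq hz).trans ?_)
  simp [h0]

/-- Asymptotic alternative, exponential form: RH holds iff
`limsup |λ_n^L|^{1/n} ≤ 1`. -/
theorem RH_iff_limsup_le_one :
    RiemannHypothesis ↔
      Filter.limsup (fun n : ℕ => |lambdaL n| ^ ((n : ℝ)⁻¹)) Filter.atTop ≤ 1 := by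
  rw [riemannHypothesis_iff_xiDisc_ne_zero]
  exact ⟨limsup_le_one_of_xiDisc_ne_zero, xiDisc_ne_zero_of_limsup_le_one⟩
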